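/- Assume cov(ℳ) = 𝔠. Then there exists a Mazurkiewicz set M ⊆ ℝ × ℝ such that for every θ ∈ ℝ there exist Sierpiński–Zygmund functions f g : ℝ → ℝ with ρ_θ(M) = {(x, f x) | x ∈ ℝ} ∪ {(x, g x) | x ∈ ℝ}. -/

import Mathlib

open Cardinal Set

noncomputable section

/-- The line through `p` with direction `v`. -/
def lineThrough (p v : ℝ × ℝ) : Set (ℝ × ℝ) := {q | ∃ t : ℝ, q = p + t • v}

/-- `L` is a straight line of `ℝ²`. -/
def IsLine (L : Set (ℝ × ℝ)) : Prop := ∃ p v : ℝ × ℝ, v ≠ 0 ∧ L = lineThrough p v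

/-- `L` is a vertical line of `ℝ²`. -/
def IsVerticalLine (L : Set (ℝ × ℝ)) : Prop := ∃ x : ℝ, L = {p : ℝ × ℝ | p.1 = x}

/-- `L₁` and `L₂` are parallel lines. -/
def ParallelLines (L₁ L₂ : Set (ℝ × ℝ)) : Prop :=
  ∃ (p₁ p₂ v : ℝ × ℝ) (c : ℝ), v ≠ 0 ∧ c ≠ 0 ∧
    L₁ = lineThrough p₁ v ∧ L₂ = lineThrough p₂ (c • v)

/-- A Mazurkiewicz set meets every line in exactly two points. -/
def IsMazurkiewicz (M : Set (ℝ × ℝ)) : Prop :=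
  ∀ L : Set (ℝ × ℝ), IsLine L → (M ∩ L).encard = 2

/-- The graph of a partial function `g` defined on `S ⊆ ℝ`. -/
def graphOn (S : Set ℝ) (g : S → ℝ) : Set (ℝ × ℝ) := {p | ∃ x : S, p = ((x : ℝ), g x)}

/-- The graph of a function `f : ℝ → ℝ`. -/
def graphOf (f : ℝ → ℝ) : Set (ℝ × ℝ) := {p | ∃ x : ℝ, p = (x, f x)}

/-- A Sierpiński–Zygmund set. -/
def IsSZSet (X : Set (ℝ × ℝ)) : Prop :=
  ∀ (S : Set ℝ) (g : S → ℝ), Continuous g →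
    #↥(X ∩ graphOn S g) < Cardinal.continuum

/-- A Sierpiński–Zygmund function. -/
def IsSZFun (f : ℝ → ℝ) : Prop :=
  ∀ (S : Set ℝ) (g : S → ℝ), Continuous g →
    #↥{x : S | f x.1 = g x} < Cardinal.continuum

/-- Rotation about the origin by angle `θ`. -/
def rot (θ : ℝ) (p : ℝ × ℝ) : ℝ × ℝ :=
  (p.1 * Real.cos θ - p.2 * Real.sin θ, p.1 * Real.sin θ + p.2 * Real.cos θ)

/-- A Hamel basis of `ℝ²`: a basis of `ℝ × ℝ` as a vector space over `ℚ`. -/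
def IsHamelBasis (H : Set (ℝ × ℝ)) : Prop :=
  LinearIndependent ℚ ((↑) : H → ℝ × ℝ) ∧ Submodule.span ℚ H = ⊤

/-- A Hamel function: a function whose graph is a Hamel basis of `ℝ²`. -/
def IsHamelFun (h : ℝ → ℝ) : Prop := IsHamelBasis (graphOf h)

/-- `cov(ℳ) = 𝔠`: no union of fewer than `𝔠`-many meager subsets of `ℝ` covers `ℝ`. -/
def CovMeagerEqContinuum : Prop :=
  ∀ (I : Type) (A : I → Set ℝ), #I < Cardinal.continuum →
    (∀ i : I, IsMeagre (A i)) → (⋃ i : I, A i) ≠ Set.univ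

/-! ### Lines and collinearity -/

/-- Twice the signed area of the triangle `x y z`; it vanishes iff the points are collinear. -/
def orient (x y z : ℝ × ℝ) : ℝ :=
  (y.1 - x.1) * (z.2 - x.2) - (y.2 - x.2) * (z.1 - x.1)

/-- No three distinct points of `P` are collinear. -/
def NoThreeCollinear (P : Set (ℝ × ℝ)) : Prop :=
  ∀ x ∈ P, ∀ y ∈ P, ∀ z ∈ P, x ≠ y → y ≠ z → x ≠ z → orient x y z ≠ 0

lemma orient_eq_zero_of_mem_lineThrough {p v x y z : ℝ × ℝ} (hx : x ∈ lineThrough p v)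
    (hy : y ∈ lineThrough p v) (hz : z ∈ lineThrough p v) : orient x y z = 0 := by
  obtain ⟨a, rfl⟩ := hx
  obtain ⟨b, rfl⟩ := hy
  obtain ⟨c, rfl⟩ := hz
  simp only [orient, Prod.fst_add, Prod.snd_add, Prod.smul_fst, Prod.smul_snd, smul_eq_mul]
  ring

lemma NoThreeCollinear.insert {P : Set (ℝ × ℝ)} (hP : NoThreeCollinear P) {z : ℝ × ℝ}
    (hz : ∀ x ∈ P, ∀ y ∈ P, x ≠ y → orient x y z ≠ 0) : NoThreeCollinear (insert z P) := by
  have h₁ (a b c) (h : orient a b c ≠ 0) : orient b c a ≠ 0 := by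
    unfold orient at *
    contrapose! h
    linarith
  rintro a (rfl | ha) b (rfl | hb) c (rfl | hc) hab hbc hac
  · exact absurd rfl hab
  · exact absurd rfl hab
  · exact absurd rfl hac
  · exact h₁ _ _ _ (h₁ _ _ _ (hz b hb c hc hbc))
  · exact absurd rfl hbc
  · exact h₁ _ _ _ (hz c hc a ha (Ne.symm hac))
  · exact hz a ha b hb hab
  · exact hP a ha b hb c hc hab hbc hac

lemma mem_lineThrough_iff {p v x : ℝ × ℝ} (hv : v ≠ 0) :
    x ∈ lineThrough p v ↔ (x.1 - p.1) * v.2 - (x.2 - p.2) * v.1 = 0 := by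
  constructor
  · rintro ⟨t, rfl⟩
    simp only [Prod.fst_add, Prod.snd_add, Prod.smul_fst, Prod.smul_snd, smul_eq_mul]
    ring
  · intro h
    by_cases h1 : v.1 = 0
    · have h2 : v.2 ≠ 0 := fun h2 => hv (Prod.ext h1 h2)
      refine ⟨(x.2 - p.2) / v.2, Prod.ext ?_ ?_⟩
      · rw [h1, mul_zero, sub_zero] at h
        have := (mul_eq_zero.1 h).resolve_right h2
        simp [h1]
        linarith
      · simp [h2]
    · refine ⟨(x.1 - p.1) / v.1, Prod.ext ?_ ?_⟩
      · simp [h1]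
      · simp
        field_simp
        linarith

lemma subsingleton_orient_eq_zero {p v x y : ℝ × ℝ} (hv : v ≠ 0) (hxy : x ≠ y)
    (h : ¬ (x ∈ lineThrough p v ∧ y ∈ lineThrough p v)) :
    {t : ℝ | orient x y (p + t • v) = 0}.Subsingleton := by
  intro s hs t ht
  by_contra hst
  apply h
  simp only [orient, mem_ofPred_eq, Prod.fst_add, Prod.snd_add, Prod.smul_fst, Prod.smul_snd,
    smul_eq_mul] at hs ht
  have hd : (y.1 - x.1) * v.2 - (y.2 - x.2) * v.1 = 0 := by
    have : (s - t) * ((y.1 - x.1) * v.2 - (y.2 - x.2) * v.1) = 0 := by linear_combination hs - ht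
    exact (mul_eq_zero.1 this).resolve_left (sub_ne_zero.2 hst)
  have hc : (y.1 - x.1) * (p.2 - x.2) - (y.2 - x.2) * (p.1 - x.1) = 0 := by
    linear_combination hs - s * hd
  have key : (x.1 - p.1) * v.2 - (x.2 - p.2) * v.1 = 0 := by
    by_cases h1 : y.1 - x.1 = 0
    · have h2 : y.2 - x.2 ≠ 0 := fun h2 => hxy (Prod.ext (by linarith) (by linarith))
      have hv1 : v.1 = 0 := by
        rw [h1] at hd
        have : (y.2 - x.2) * v.1 = 0 := by linarith
        exact (mul_eq_zero.1 this).resolve_left h2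
      have hp1 : p.1 - x.1 = 0 := by
        rw [h1] at hc
        have : (y.2 - x.2) * (p.1 - x.1) = 0 := by linarith
        exact (mul_eq_zero.1 this).resolve_left h2
      rw [hv1]
      linear_combination -v.2 * hp1
    · have : (y.1 - x.1) * ((x.1 - p.1) * v.2 - (x.2 - p.2) * v.1) = 0 := by
        linear_combination (x.1 - p.1) * hd + v.1 * hc
      exact (mul_eq_zero.1 this).resolve_left h1
  rw [mem_lineThrough_iff hv, mem_lineThrough_iff hv]
  exact ⟨key, by linear_combination key + hd⟩

lemma Set.Subsingleton.isNowhereDense_real {s : Set ℝ} (h : s.Subsingleton) :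
    IsNowhereDense s := by
  rcases h.eq_empty_or_singleton with rfl | ⟨x, rfl⟩
  · exact isNowhereDense_empty
  · exact isClosed_singleton.isNowhereDense_iff.2 (interior_singleton x)

/-! ### One step of the construction -/

/-- The lines in which `K` is not nowhere dense. -/
def badLines (K : Set (ℝ × ℝ)) : Set (Set (ℝ × ℝ)) :=
  {L | ∃ p v : ℝ × ℝ, v ≠ 0 ∧ L = lineThrough p v ∧ ¬ IsNowhereDense {t : ℝ | p + t • v ∈ K}}

lemma exists_point_on_line (hcov : CovMeagerEqContinuum) {P : Set (ℝ × ℝ)}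
    (hP : NoThreeCollinear P) (hcard : #P < 𝔠) {p v : ℝ × ℝ} (hv : v ≠ 0)
    (hL : (P ∩ lineThrough p v).Subsingleton) {I : Type} (hI : #I < 𝔠)
    (K : I → Set (ℝ × ℝ)) :
    ∃ z ∈ lineThrough p v, z ∉ P ∧ NoThreeCollinear (insert z P) ∧
      ∀ i, lineThrough p v ∉ badLines (K i) → z ∉ K i := by
  let A : ({i // lineThrough p v ∉ badLines (K i)} ⊕ {q : P × P // q.1 ≠ q.2}) ⊕ P → Set ℝ :=
    Sum.elim (Sum.elim (fun i => {t | p + t • v ∈ K i})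
      (fun q => {t | orient q.1.1 q.1.2 (p + t • v) = 0})) (fun x => {t | p + t • v = x})
  have hA : (⋃ i, A i) ≠ Set.univ := by
    refine hcov _ A ?_ ?_
    · have hmul := Cardinal.mul_lt_of_lt aleph0_le_continuum hcard hcard
      simp only [mk_sum, Cardinal.lift_id]
      refine add_lt_of_lt aleph0_le_continuum (add_lt_of_lt aleph0_le_continuum ?_ ?_) hcard
      · exact (mk_subtype_le _).trans_lt hI
      · refine (mk_subtype_le _).trans_lt ?_
        simpa using hmul
    · rintro ((i | q) | x)
      · refine IsNowhereDense.isMeagre ?_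
        by_contra h
        exact i.2 ⟨p, v, hv, rfl, h⟩
      · refine (subsingleton_orient_eq_zero hv (fun h => q.2 (Subtype.ext h))
          fun h => q.2 (Subtype.ext ?_)).isNowhereDense_real.isMeagre
        exact hL ⟨q.1.1.2, h.1⟩ ⟨q.1.2.2, h.2⟩
      · refine (Set.Subsingleton.isNowhereDense_real ?_).isMeagre
        intro s hs t ht
        have : s • v = t • v := add_left_cancel (hs.trans ht.symm)
        exact smul_left_injective ℝ hv this
  obtain ⟨t, ht⟩ := (ne_univ_iff_exists_notMem _).1 hA
  simp only [mem_iUnion, not_exists] at ht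
  refine ⟨p + t • v, ⟨t, rfl⟩, fun h => ht (Sum.inr ⟨_, h⟩) rfl, hP.insert ?_, ?_⟩
  · intro x hx y hy hxy h
    exact ht (Sum.inl (Sum.inr ⟨(⟨x, hx⟩, ⟨y, hy⟩), fun h => hxy (congrArg Subtype.val h)⟩)) h
  · intro i hi h
    exact ht (Sum.inl (Sum.inl ⟨i, hi⟩)) h

/-- `A` is an admissible set of new points on the line `L`, given the previous points `P` and the
sets `K i` to be avoided. -/
structure IsAdmissible {I : Type} (K : I → Set (ℝ × ℝ)) (L P A : Set (ℝ × ℝ)) : Prop where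
  finite : A.Finite
  subset : A ⊆ L
  noThreeCollinear : NoThreeCollinear (P ∪ A)
  nontrivial : ((P ∪ A) ∩ L).Nontrivial
  notMem : ∀ i, L ∉ badLines (K i) → ∀ z ∈ A, z ∉ K i

lemma exists_isAdmissible (hcov : CovMeagerEqContinuum) {P : Set (ℝ × ℝ)}
    (hP : NoThreeCollinear P) (hcard : #P < 𝔠) {p v : ℝ × ℝ} (hv : v ≠ 0)
    {I : Type} (hI : #I < 𝔠) (K : I → Set (ℝ × ℝ)) :
    ∃ A, IsAdmissible K (lineThrough p v) P A := by
  by_cases h₀ : (P ∩ lineThrough p v).Subsingleton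
  swap
  · exact ⟨∅, finite_empty, empty_subset _, by simpa using hP,
      by simpa using not_subsingleton_iff.1 h₀, by simp⟩
  obtain ⟨z, hzL, hzP, hz, hzK⟩ := exists_point_on_line hcov hP hcard hv h₀ hI K
  by_cases h₁ : (insert z P ∩ lineThrough p v).Subsingleton
  swap
  · exact ⟨{z}, finite_singleton z, by simpa using hzL, by simpa using hz,
      by simpa using not_subsingleton_iff.1 h₁, by simpa using hzK⟩
  have hcard' : #(insert z P : Set (ℝ × ℝ)) < 𝔠 :=
    mk_insert_le.trans_lt (add_lt_of_lt aleph0_le_continuum hcard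
      (one_lt_aleph0.trans aleph0_lt_continuum))
  obtain ⟨w, hwL, hwP, hw, hwK⟩ := exists_point_on_line hcov hz hcard' hv h₁ hI K
  have hunion : P ∪ {w, z} = insert w (insert z P) := by
    ext
    simp only [mem_union, mem_insert_iff, mem_singleton_iff]
    tauto
  refine ⟨{w, z}, toFinite _, ?_, ?_, ?_, ?_⟩
  · rintro _ (rfl | rfl) <;> assumption
  · rwa [hunion]
  · rw [hunion]
    exact ⟨w, ⟨mem_insert _ _, hwL⟩, z, ⟨mem_insert_of_mem _ (mem_insert _ _), hzL⟩,
      fun h => hwP (h ▸ mem_insert _ _)⟩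
  · rintro i hi _ (rfl | rfl)
    · exact hwK i hi
    · exact hzK i hi

/-! ### The transfinite construction -/

lemma exists_transfinite_choice {J X : Type*} [LinearOrder J] [WellFoundedLT J]
    (G : J → Set X → Set X → Prop) :
    ∃ F : J → Set X, ∀ j, (∃ A, G j (⋃ i ∈ Iio j, F i) A) → G j (⋃ i ∈ Iio j, F i) (F j) := by
  let step (j : J) (prev : ∀ i, i < j → Set X) : Set X :=
    Classical.epsilon fun A => G j (⋃ (i) (h : i < j), prev i h) A
  refine ⟨(wellFounded_lt (α := J)).fix step, fun j hj => ?_⟩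
  have := Classical.epsilon_spec hj
  rw [WellFounded.fix_eq]
  exact this

lemma noThreeCollinear_biUnion {J : Type*} [LinearOrder J] {F : J → Set (ℝ × ℝ)} {s : Set J}
    (h : ∀ j ∈ s, NoThreeCollinear ((⋃ i ∈ Iio j, F i) ∪ F j)) :
    NoThreeCollinear (⋃ j ∈ s, F j) := by
  intro x hx y hy z hz
  simp only [mem_iUnion₂] at hx hy hz
  obtain ⟨a, ha, hx⟩ := hx
  obtain ⟨b, hb, hy⟩ := hy
  obtain ⟨c, hc, hz⟩ := hz
  have hm : max a (max b c) ∈ s := by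
    have hmax {i j : J} (hi : i ∈ s) (hj : j ∈ s) : max i j ∈ s := by
      rcases max_choice i j with h | h <;> rwa [h]
    exact hmax ha (hmax hb hc)
  have hsub {i : J} (hi : i ≤ max a (max b c)) :
      F i ⊆ (⋃ i ∈ Iio (max a (max b c)), F i) ∪ F (max a (max b c)) := by
    rcases hi.eq_or_lt with h | h
    · rw [← h]
      exact subset_union_right
    · exact (subset_biUnion_of_mem (u := F) (mem_Iio.2 h)).trans subset_union_left
  exact h _ hm x (hsub (le_max_left _ _) hx)
    y (hsub (le_max_of_le_right (le_max_left _ _)) hy)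
    z (hsub (le_max_of_le_right (le_max_right _ _)) hz)

lemma mk_biUnion_lt_continuum {J X : Type} {s : Set J} (hs : #s < 𝔠) {F : J → Set X}
    (hF : ∀ j ∈ s, (F j).Countable) : #(⋃ j ∈ s, F j : Set X) < 𝔠 := by
  refine (mk_biUnion_le F s).trans_lt ?_
  refine lt_of_le_of_lt (b := #s * ℵ₀) ?_
    (Cardinal.mul_lt_of_lt aleph0_le_continuum hs aleph0_lt_continuum)
  gcongr
  exact ciSup_le' fun j => (hF j j.2).le_aleph0

lemma exists_surjective_of_mk_le {X Y : Type} [Nonempty X] (h : #X ≤ #Y) :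
    ∃ f : Y → X, Function.Surjective f := by
  obtain ⟨e⟩ := h
  exact ⟨_, Function.invFun_surjective e.injective⟩

/-- A Mazurkiewicz set having small intersection with each of `𝔠` many given sets that are nowhere
dense in all but countably many lines. -/
lemma exists_isMazurkiewicz_mk_inter_lt (hcov : CovMeagerEqContinuum) {I : Type} [Nonempty I]
    (hI : #I ≤ 𝔠) (K : I → Set (ℝ × ℝ)) (hK : ∀ i, (badLines (K i)).Countable) :
    ∃ M, IsMazurkiewicz M ∧ ∀ i, #(M ∩ K i : Set (ℝ × ℝ)) < 𝔠 := by
  let J := (𝔠).ord.ToType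
  have hJ : #J = 𝔠 := mk_ord_toType 𝔠
  let Λ := {l : (ℝ × ℝ) × (ℝ × ℝ) // l.2 ≠ 0}
  have : Nonempty Λ := ⟨⟨(0, (1, 0)), by simp⟩⟩
  have hΛ : #Λ ≤ #J := by
    rw [hJ]
    refine (mk_subtype_le _).trans ?_
    simp [mk_real]
  obtain ⟨l, hl⟩ := exists_surjective_of_mk_le hΛ
  obtain ⟨k, hk⟩ := exists_surjective_of_mk_le (hI.trans_eq hJ.symm)
  have hseg (j : J) : #(Iio j) < 𝔠 := (mk_Iio_lt j (by simp [J])).trans_eq hJ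
  let L (j : J) := lineThrough (l j).1.1 (l j).1.2
  obtain ⟨F, hF⟩ := exists_transfinite_choice fun (j : J) P A =>
    IsAdmissible (fun i : Iio j => K (k i)) (L j) P A
  have adm (j : J) : IsAdmissible (fun i : Iio j => K (k i)) (L j) (⋃ i ∈ Iio j, F i) (F j) := by
    induction j using WellFoundedLT.induction with
    | _ j ih =>
      refine hF j (exists_isAdmissible hcov ?_ ?_ (l j).2 (hseg j) _)
      · exact noThreeCollinear_biUnion fun i hi => (ih i hi).noThreeCollinear
      · exact mk_biUnion_lt_continuum (hseg j) fun i hi => (ih i hi).finite.countable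
  have hM : NoThreeCollinear (⋃ j, F j) := by
    rw [← biUnion_univ]
    exact noThreeCollinear_biUnion fun j _ => (adm j).noThreeCollinear
  have hMaz : IsMazurkiewicz (⋃ j, F j) := by
    rintro _ ⟨p, v, hv, rfl⟩
    obtain ⟨j, hj⟩ := hl ⟨(p, v), hv⟩
    obtain ⟨x, hx, y, hy, hxy⟩ := (adm j).nontrivial
    simp only [L, hj] at hx hy
    have hsub : (⋃ i ∈ Iio j, F i) ∪ F j ⊆ ⋃ j, F j :=
      union_subset (iUnion₂_subset fun i _ => subset_iUnion F i) (subset_iUnion F j)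
    refine encard_eq_two.2 ⟨x, y, hxy, Subset.antisymm ?_ ?_⟩
    · rintro z ⟨hzM, hzL⟩
      by_contra hz
      simp only [mem_insert_iff, mem_singleton_iff, not_or] at hz
      exact hM x (hsub hx.1) y (hsub hy.1) z hzM hxy (Ne.symm hz.2) (Ne.symm hz.1)
        (orient_eq_zero_of_mem_lineThrough hx.2 hy.2 hzL)
    · rintro _ (rfl | rfl)
      · exact ⟨hsub hx.1, hx.2⟩
      · exact ⟨hsub hy.1, hy.2⟩
  refine ⟨⋃ j, F j, hMaz, fun i => ?_⟩
  obtain ⟨j, rfl⟩ := hk i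
  have hsub : (⋃ j, F j) ∩ K (k j) ⊆ ((⋃ i ∈ Iio j, F i) ∪ F j) ∪
      ⋃ L ∈ badLines (K (k j)), (⋃ j, F j) ∩ L := by
    rintro z ⟨hzM, hzK⟩
    obtain ⟨a, hza⟩ := mem_iUnion.1 hzM
    rcases lt_trichotomy a j with h | rfl | h
    · exact Or.inl (Or.inl (mem_iUnion₂.2 ⟨a, h, hza⟩))
    · exact Or.inl (Or.inr hza)
    · refine Or.inr (mem_iUnion₂.2 ⟨L a, ?_, hzM, (adm a).subset hza⟩)
      by_contra hbad
      exact (adm a).notMem ⟨j, h⟩ hbad z hza hzK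
  have hcount : (⋃ L ∈ badLines (K (k j)), (⋃ j, F j) ∩ L).Countable := by
    refine (hK _).biUnion ?_
    rintro _ ⟨p, v, hv, rfl, -⟩
    exact (finite_of_encard_eq_coe (hMaz _ ⟨p, v, hv, rfl⟩)).countable
  refine (mk_le_mk_of_subset hsub).trans_lt ((mk_union_le _ _).trans_lt ?_)
  refine add_lt_of_lt aleph0_le_continuum ((mk_union_le _ _).trans_lt ?_)
    (hcount.le_aleph0.trans_lt aleph0_lt_continuum)
  exact add_lt_of_lt aleph0_le_continuum
    (mk_biUnion_lt_continuum (hseg j) fun i _ => (adm i).finite.countable)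
    ((adm j).finite.countable.le_aleph0.trans_lt aleph0_lt_continuum)

/-! ### Graphs of continuous partial functions -/

lemma countable_setOf_Ioo_subset_closure {S : Set ℝ} {h : ℝ → ℝ} (hc : ContinuousOn h S) :
    {ab : ℝ × ℝ | ∃ q : ℚ × ℚ, q.1 < q.2 ∧
      Ioo (q.1 : ℝ) q.2 ⊆ closure {x | x ∈ S ∧ h x = ab.1 * x + ab.2}}.Countable := by
  rw [ofPred_exists]
  refine countable_iUnion fun q => Set.Subsingleton.countable ?_
  rintro ⟨a, b⟩ ⟨hq, hab⟩ ⟨c, d⟩ ⟨-, hcd⟩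
  simp only at hab hcd
  have hq' : (q.1 : ℝ) < q.2 := by exact_mod_cast hq
  have hclosed : IsClosed {x : ℝ | a * x + b = c * x + d} :=
    isClosed_eq (by fun_prop) (by fun_prop)
  have heq : Ioo (q.1 : ℝ) q.2 ∩ {x | x ∈ S ∧ h x = a * x + b} ⊆
      {x : ℝ | a * x + b = c * x + d} := by
    rintro x ⟨hx, hxS, hxh⟩
    have hcl := hcd hx
    rw [mem_closure_iff_nhdsWithin_neBot] at hcl
    have h₁ : Filter.Tendsto h (nhdsWithin x {x | x ∈ S ∧ h x = c * x + d})
        (nhds (a * x + b)) := hxh ▸ (hc x hxS).mono_left (nhdsWithin_mono _ fun y hy => hy.1)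
    have h₂ : Filter.Tendsto h (nhdsWithin x {x | x ∈ S ∧ h x = c * x + d})
        (nhds (c * x + d)) := by
      have : Filter.Tendsto (fun y => c * y + d) (nhdsWithin x {x | x ∈ S ∧ h x = c * x + d})
          (nhds (c * x + d)) := Continuous.continuousWithinAt (by fun_prop)
      exact this.congr' (Filter.eventuallyEq_of_mem self_mem_nhdsWithin fun y hy => hy.2.symm)
    exact tendsto_nhds_unique h₁ h₂
  have hall : Ioo (q.1 : ℝ) q.2 ⊆ {x : ℝ | a * x + b = c * x + d} := fun x hx =>
    closure_minimal heq hclosed (isOpen_Ioo.inter_closure ⟨hx, hab hx⟩)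
  obtain ⟨x, hx⟩ := exists_between hq'
  obtain ⟨y, hy⟩ := exists_between hx.2
  have ex := hall hx
  have ey := hall ⟨hx.1.trans hy.1, hy.2⟩
  simp only [mem_ofPred_eq] at ex ey
  have hac : a = c := by
    have : (y - x) * (a - c) = 0 := by linear_combination ey - ex
    exact sub_eq_zero.1 ((mul_eq_zero.1 this).resolve_left (sub_ne_zero.2 hy.1.ne'))
  subst hac
  exact Prod.ext rfl (by simpa using ex)

lemma countable_badLines_graph {S : Set ℝ} {h : ℝ → ℝ} (hc : ContinuousOn h S) :
    (badLines {p | p.1 ∈ S ∧ h p.1 = p.2}).Countable := by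
  refine ((countable_setOf_Ioo_subset_closure hc).image
    fun ab : ℝ × ℝ => lineThrough (0, ab.2) (1, ab.1)).mono ?_
  rintro _ ⟨p, v, hv, rfl, hbad⟩
  have hv1 : v.1 ≠ 0 := by
    intro hv1
    have hv2 : v.2 ≠ 0 := fun hv2 => hv (Prod.ext hv1 hv2)
    refine hbad (Set.Subsingleton.isNowhereDense_real ?_)
    rintro s ⟨-, hs⟩ t ⟨-, ht⟩
    simp only [Prod.fst_add, Prod.snd_add, Prod.smul_fst, Prod.smul_snd, smul_eq_mul, hv1,
      mul_zero, add_zero] at hs ht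
    exact mul_right_cancel₀ hv2 (by linarith)
  let e : ℝ ≃ₜ ℝ := (Homeomorph.mulRight₀ v.1 hv1).trans (Homeomorph.addLeft p.1)
  have he (t : ℝ) : e t = p.1 + t * v.1 := rfl
  set N := {t : ℝ | p + t • v ∈ {p : ℝ × ℝ | p.1 ∈ S ∧ h p.1 = p.2}}
  have himg : e '' N ⊆ {x | x ∈ S ∧ h x = v.2 / v.1 * x + (p.2 - v.2 / v.1 * p.1)} := by
    rintro _ ⟨t, ⟨ht, ht'⟩, rfl⟩
    simp only [Prod.fst_add, Prod.snd_add, Prod.smul_fst, Prod.smul_snd, smul_eq_mul] at ht ht'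
    refine ⟨ht, ?_⟩
    rw [he, ht']
    field_simp
    ring
  obtain ⟨t, ht⟩ := nonempty_iff_ne_empty.2 hbad
  obtain ⟨u, hu, htu, hsub⟩ := Real.isTopologicalBasis_Ioo_rat.exists_subset_of_mem_open
    (mem_image_of_mem e ht) (e.isOpenMap _ isOpen_interior)
  simp only [mem_iUnion, mem_singleton_iff] at hu
  obtain ⟨a, b, hab, rfl⟩ := hu
  refine ⟨(v.2 / v.1, p.2 - v.2 / v.1 * p.1), ⟨(a, b), hab, ?_⟩, ?_⟩
  · refine hsub.trans ((image_mono interior_subset).trans ?_)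
    rw [e.image_closure]
    exact closure_mono himg
  · ext x
    rw [mem_lineThrough_iff hv, mem_lineThrough_iff (by simp)]
    simp only [sub_zero, mul_one]
    field_simp
    constructor <;> intro h <;> linarith

/-- The points of `u` prescribe a function on a countable set; this is the graph of its continuous
extension to all points of the closure where the limit exists. -/
def limitGraph (u : ℕ → ℝ × ℝ) : Set (ℝ × ℝ) :=
  let A := range fun n => (u n).1
  let f := Function.extend (fun n => (u n).1) (fun n => (u n).2) 0
  {p | p.1 ∈ {x ∈ closure A | ∃ y, Filter.Tendsto f (nhdsWithin x A) (nhds y)} ∧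
    extendFrom A f p.1 = p.2}

lemma countable_badLines_limitGraph (u : ℕ → ℝ × ℝ) : (badLines (limitGraph u)).Countable :=
  countable_badLines_graph (continuousOn_extendFrom (fun _ hx => hx.1) fun _ hx => hx.2)

lemma exists_graphOn_subset_limitGraph {S : Set ℝ} {g : S → ℝ} (hg : Continuous g) :
    ∃ u, graphOn S g ⊆ limitGraph u := by
  rcases isEmpty_or_nonempty S with hS | hS
  · refine ⟨0, ?_⟩
    rintro _ ⟨x, rfl⟩
    exact hS.elim x
  let d := TopologicalSpace.denseSeq S
  refine ⟨fun n => (d n, g (d n)), ?_⟩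
  rintro _ ⟨x, rfl⟩
  set A := range fun n => (d n : ℝ) with hA
  set f := Function.extend (fun n => (d n : ℝ)) (fun n => g (d n)) 0
  have hfd (n : ℕ) : f (d n) = g (d n) :=
    Function.FactorsThrough.extend_apply (fun a b h => congrArg g (Subtype.ext h)) 0 n
  have hAimg : A = Subtype.val '' range d := by
    rw [hA, ← range_comp]
    rfl
  have hx : (x : ℝ) ∈ closure A := by
    rw [hAimg]
    exact image_closure_subset_closure_image continuous_subtype_val
      ⟨x, TopologicalSpace.denseRange_denseSeq S x, rfl⟩
  have hlim : Filter.Tendsto f (nhdsWithin (x : ℝ) A) (nhds (g x)) := by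
    have hmap : nhdsWithin (x : ℝ) A = Filter.map Subtype.val (nhdsWithin x (range d)) := by
      rw [hAimg, Topology.IsInducing.subtypeVal.map_nhdsWithin_eq]
    rw [hmap, Filter.tendsto_map'_iff]
    refine Filter.Tendsto.congr' ?_ (hg.continuousWithinAt (s := range d) (x := x))
    refine Filter.eventuallyEq_of_mem self_mem_nhdsWithin ?_
    rintro _ ⟨n, rfl⟩
    exact (hfd n).symm
  exact ⟨⟨hx, g x, hlim⟩, extendFrom_eq hx hlim⟩

/-! ### Rotations -/

lemma rot_add_smul (θ : ℝ) (p v : ℝ × ℝ) (t : ℝ) :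
    rot θ (p + t • v) = rot θ p + t • rot θ v := by
  ext <;> simp [rot] <;> ring

lemma rot_neg_rot (θ : ℝ) (p : ℝ × ℝ) : rot (-θ) (rot θ p) = p := by
  have := Real.sin_sq_add_cos_sq θ
  ext <;> simp only [rot, Real.cos_neg, Real.sin_neg]
  · linear_combination p.1 * this
  · linear_combination p.2 * this

lemma rot_rot_neg (θ : ℝ) (p : ℝ × ℝ) : rot θ (rot (-θ) p) = p := by
  simpa using rot_neg_rot (-θ) p

lemma rot_injective (θ : ℝ) : Function.Injective (rot θ) :=
  Function.LeftInverse.injective (rot_neg_rot θ)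

lemma rot_zero_right (θ : ℝ) : rot θ 0 = 0 := by
  ext <;> simp [rot]

lemma rot_ne_zero (θ : ℝ) {v : ℝ × ℝ} (hv : v ≠ 0) : rot θ v ≠ 0 := fun h =>
  hv (rot_injective θ (h.trans (rot_zero_right θ).symm))

lemma countable_badLines_preimage_rot (θ : ℝ) {K : Set (ℝ × ℝ)} (hK : (badLines K).Countable) :
    (badLines (rot θ ⁻¹' K)).Countable := by
  refine (hK.preimage_of_injOn (f := image (rot θ))
    (rot_injective θ).image_injective.injOn).mono ?_
  rintro _ ⟨p, v, hv, rfl, hbad⟩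
  refine ⟨rot θ p, rot θ v, rot_ne_zero θ hv, ?_, ?_⟩
  · ext q
    constructor
    · rintro ⟨_, ⟨t, rfl⟩, rfl⟩
      exact ⟨t, rot_add_smul θ p v t⟩
    · rintro ⟨t, rfl⟩
      exact ⟨_, ⟨t, rfl⟩, rot_add_smul θ p v t⟩
  · simpa only [mem_preimage, rot_add_smul] using hbad

lemma isLine_setOf_rot_fst_eq (θ x : ℝ) : IsLine {p | (rot θ p).1 = x} := by
  refine ⟨rot (-θ) (x, 0), rot (-θ) (0, 1), rot_ne_zero _ (by simp), ?_⟩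
  ext q
  constructor
  · intro hq
    refine ⟨(rot θ q).2, ?_⟩
    rw [← rot_add_smul, ← rot_neg_rot θ q, rot_rot_neg]
    congr 1
    exact Prod.ext (by simpa using hq) (by simp)
  · rintro ⟨t, rfl⟩
    simp [← rot_add_smul, rot_rot_neg]

lemma isSZFun_of_mk_inter_lt {M : Set (ℝ × ℝ)} {θ : ℝ}
    (hM : ∀ u, #(M ∩ rot θ ⁻¹' limitGraph u : Set (ℝ × ℝ)) < 𝔠) {f : ℝ → ℝ}
    (hf : graphOf f ⊆ rot θ '' M) : IsSZFun f := by
  intro S g hg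
  obtain ⟨u, hu⟩ := exists_graphOn_subset_limitGraph hg
  refine lt_of_le_of_lt ?_ (hM u)
  choose a haM ha using fun x : ℝ => hf ⟨x, rfl⟩
  refine mk_le_of_injective (f := fun x : {x : S | f x.1 = g x} =>
    (⟨a x.1, haM _, hu ⟨x.1, by rw [ha, x.2]⟩⟩ : (M ∩ rot θ ⁻¹' limitGraph u : Set (ℝ × ℝ)))) ?_
  intro x y hxy
  have h : a x.1 = a y.1 := congrArg Subtype.val hxy
  have h' := congrArg (fun p => (rot θ p).1) h
  simp only [ha] at h'
  exact Subtype.ext (Subtype.ext h')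

lemma IsMazurkiewicz.exists_rot_image_eq {M : Set (ℝ × ℝ)} (hM : IsMazurkiewicz M) (θ : ℝ) :
    ∃ f g : ℝ → ℝ, rot θ '' M = graphOf f ∪ graphOf g := by
  choose a b _ hM' using fun x => encard_eq_two.1 (hM _ (isLine_setOf_rot_fst_eq θ x))
  have ha (x) : a x ∈ M ∩ {p | (rot θ p).1 = x} := hM' x ▸ mem_insert _ _
  have hb (x) : b x ∈ M ∩ {p | (rot θ p).1 = x} := hM' x ▸ mem_insert_of_mem _ rfl
  refine ⟨fun x => (rot θ (a x)).2, fun x => (rot θ (b x)).2, Subset.antisymm ?_ ?_⟩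
  · rintro _ ⟨p, hp, rfl⟩
    have : p ∈ M ∩ {q | (rot θ q).1 = (rot θ p).1} := ⟨hp, rfl⟩
    rw [hM'] at this
    rcases this with h | h
    · exact Or.inl ⟨(rot θ p).1, Prod.ext rfl (congrArg (fun q => (rot θ q).2) h)⟩
    · exact Or.inr ⟨(rot θ p).1, Prod.ext rfl (congrArg (fun q => (rot θ q).2) h)⟩
  · rintro _ (⟨x, rfl⟩ | ⟨x, rfl⟩)
    · exact ⟨a x, (ha x).1, Prod.ext (ha x).2 rfl⟩
    · exact ⟨b x, (hb x).1, Prod.ext (hb x).2 rfl⟩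

/-- Assuming `cov(ℳ) = 𝔠`, there is a Mazurkiewicz set that is a union of two
Sierpiński–Zygmund functions in every direction. -/
theorem stmt_14 (hcov : CovMeagerEqContinuum) :
    ∃ M : Set (ℝ × ℝ), IsMazurkiewicz M ∧
      ∀ θ : ℝ, ∃ f g : ℝ → ℝ, IsSZFun f ∧ IsSZFun g ∧
        rot θ '' M = graphOf f ∪ graphOf g := by
  have hcard : #(ℝ × (ℕ → ℝ × ℝ)) ≤ 𝔠 := by
    simp [mk_real]
  obtain ⟨M, hM, hMK⟩ := exists_isMazurkiewicz_mk_inter_lt hcov hcard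
    (fun i => rot i.1 ⁻¹' limitGraph i.2)
    fun i => countable_badLines_preimage_rot i.1 (countable_badLines_limitGraph i.2)
  refine ⟨M, hM, fun θ => ?_⟩
  obtain ⟨f, g, hfg⟩ := hM.exists_rot_image_eq θ
  exact ⟨f, g, isSZFun_of_mk_inter_lt (fun u => hMK (θ, u)) (hfg ▸ subset_union_left),
    isSZFun_of_mk_inter_lt (fun u => hMK (θ, u)) (hfg ▸ subset_union_right), hfg⟩
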